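/- Let L be any maximal layer on n channels. If there exists a sorting network with n channels and depth d, then there exists a sorting network with n channels and depth d whose first layer is L. -/

import Mathlib

/-- A comparator on `n` channels: an ordered pair of channel indices
(the first component receives the minimum, the second the maximum). -/
abbrev Comparator (n : ℕ) : Type := Fin n × Fin n

/-- A layer of a comparator network: a list of comparators. -/
abbrev Layer (n : ℕ) : Type := List (Comparator n)

/-- A comparator network: a list of layers; its depth is the length of this list. -/
abbrev Network (n : ℕ) : Type := List (Layer n)

/-- Two comparators are channel-disjoint if they share no channel. -/
def ChDisjoint {n : ℕ} (c d : Comparator n) : Prop :=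
  c.1 ≠ d.1 ∧ c.1 ≠ d.2 ∧ c.2 ≠ d.1 ∧ c.2 ≠ d.2

/-- A valid (ordinary) layer: every comparator `⟨i,j⟩` satisfies `i < j`
and every channel occurs at most once in the layer. -/
def IsLayer {n : ℕ} (L : Layer n) : Prop :=
  (∀ c ∈ L, c.1 < c.2) ∧ L.Pairwise ChDisjoint

/-- A valid (ordinary) comparator network: all its layers are valid layers. -/
def IsNetwork {n : ℕ} (C : Network n) : Prop := ∀ L ∈ C, IsLayer L

/-- Applying the comparator `c = ⟨i,j⟩` to a vector of values:
channel `i` receives the minimum and channel `j` the maximum of the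
values on channels `i` and `j`; all other channels are unchanged. -/
def applyComparator {n : ℕ} {α : Type*} [LinearOrder α] (c : Comparator n)
    (v : Fin n → α) : Fin n → α := fun k =>
  if k = c.1 then min (v c.1) (v c.2)
  else if k = c.2 then max (v c.1) (v c.2)
  else v k

/-- Applying a layer: apply all its comparators (they act on disjoint channels). -/
def applyLayer {n : ℕ} {α : Type*} [LinearOrder α] (L : Layer n)
    (v : Fin n → α) : Fin n → α :=
  L.foldl (fun w c => applyComparator c w) v

/-- Applying a network: apply its layers in sequence; `applyNetwork C x` is `C(x)`. -/
def applyNetwork {n : ℕ} {α : Type*} [LinearOrder α] (C : Network n)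
    (v : Fin n → α) : Fin n → α :=
  C.foldl (fun w L => applyLayer L w) v

/-- `C` sorts every Boolean input: `C(x)` is sorted ascendingly for all `x ∈ {0,1}ⁿ`. -/
def Sorts {n : ℕ} (C : Network n) : Prop :=
  ∀ x : Fin n → Bool, Monotone (applyNetwork C x)

/-- A sorting network: a valid comparator network sorting every Boolean input. -/
def IsSortingNetwork {n : ℕ} (C : Network n) : Prop := IsNetwork C ∧ Sorts C

/-- A maximal layer: a valid layer into which no further comparator fits,
i.e. with exactly `⌊n/2⌋` comparators. -/
def IsMaximalLayer {n : ℕ} (L : Layer n) : Prop :=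
  IsLayer L ∧ L.length = n / 2

section

variable {n : ℕ}

theorem applyComparator_eq_self {α : Type*} [LinearOrder α] {c : Comparator n} {v : Fin n → α}
    (h : v c.1 ≤ v c.2) : applyComparator c v = v := by
  funext k
  unfold applyComparator
  split_ifs with h1 h2
  · rw [h1, min_eq_left h]
  · rw [h2, max_eq_right h]
  · rfl

theorem applyLayer_eq_self {α : Type*} [LinearOrder α] {l : Layer n} {v : Fin n → α}
    (h : ∀ c ∈ l, v c.1 ≤ v c.2) : applyLayer l v = v := by
  induction l with
  | nil => rfl
  | cons c t ih =>
    change applyLayer t (applyComparator c v) = v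
    rw [applyComparator_eq_self (h c (by simp))]
    exact ih fun d hd => h d (by simp [hd])

theorem applyNetwork_eq_self {α : Type*} [LinearOrder α] {C : Network n} (hC : IsNetwork C)
    {v : Fin n → α} (hv : Monotone v) : applyNetwork C v = v := by
  induction C with
  | nil => rfl
  | cons l C ih =>
    change applyNetwork C (applyLayer l v) = v
    rw [applyLayer_eq_self fun c hc => hv ((hC l (by simp)).1 c hc).le]
    exact ih fun m hm => hC m (by simp [hm])

theorem applyLayer_apply_of_forall_ne {α : Type*} [LinearOrder α] {l : Layer n} {k : Fin n}
    (h : ∀ c ∈ l, k ≠ c.1 ∧ k ≠ c.2) (v : Fin n → α) : applyLayer l v k = v k := by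
  induction l generalizing v with
  | nil => rfl
  | cons c t ih =>
    change applyLayer t (applyComparator c v) k = v k
    rw [ih fun d hd => h d (by simp [hd])]
    obtain ⟨h1, h2⟩ := h c (by simp)
    simp [applyComparator, h1, h2]

/-- The output of a layer is ordered along each of its comparators. -/
theorem IsLayer.applyLayer_le {α : Type*} [LinearOrder α] {l : Layer n} (hl : IsLayer l)
    (v : Fin n → α) : ∀ c ∈ l, applyLayer l v c.1 ≤ applyLayer l v c.2 := by
  induction l generalizing v with
  | nil => simp
  | cons c t ih =>
    obtain ⟨hlt, hdis⟩ := hl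
    rw [List.pairwise_cons] at hdis
    intro e he
    change applyLayer t (applyComparator c v) e.1 ≤ applyLayer t (applyComparator c v) e.2
    rcases List.mem_cons.1 he with rfl | he
    · rw [applyLayer_apply_of_forall_ne fun d hd => ⟨(hdis.1 d hd).1, (hdis.1 d hd).2.1⟩,
        applyLayer_apply_of_forall_ne fun d hd => (hdis.1 d hd).2.2]
      have hne : e.2 ≠ e.1 := (hlt e (by simp)).ne'
      simp [applyComparator, hne]
    · exact ih ⟨fun d hd => hlt d (by simp [hd]), hdis.2⟩ _ e he

/-- The ordinary comparator joining the images of the channels of `c` under `π`. -/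
def Comparator.relabel (π : Equiv.Perm (Fin n)) (c : Comparator n) : Comparator n :=
  (min (π c.1) (π c.2), max (π c.1) (π c.2))

theorem ChDisjoint.relabel {c d : Comparator n} (h : ChDisjoint c d) (π : Equiv.Perm (Fin n)) :
    ChDisjoint (c.relabel π) (d.relabel π) := by
  obtain ⟨h1, h2, h3, h4⟩ := h
  have h1 := π.injective.ne h1
  have h2 := π.injective.ne h2
  have h3 := π.injective.ne h3
  have h4 := π.injective.ne h4
  unfold ChDisjoint Comparator.relabel
  grind

theorem IsLayer.map_relabel {l : Layer n} (hl : IsLayer l) (π : Equiv.Perm (Fin n)) :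
    IsLayer (l.map (Comparator.relabel π)) := by
  refine ⟨?_, hl.2.map _ fun c d h => h.relabel π⟩
  intro c hc
  obtain ⟨d, hd, rfl⟩ := List.mem_map.1 hc
  exact min_lt_max.2 (π.injective.ne (hl.1 d hd).ne)

theorem exists_applyComparator_comp {α : Type*} [LinearOrder α] (c : Comparator n)
    (hc : c.1 ≠ c.2) (π : Equiv.Perm (Fin n)) :
    ∃ σ : Equiv.Perm (Fin n), (∀ k, k ≠ c.1 → k ≠ c.2 → σ k = π k) ∧
      ∀ y : Fin n → α, applyComparator c (y ∘ π) = applyComparator (c.relabel π) y ∘ σ := by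
  have hne := π.injective.ne hc
  rcases hne.lt_or_gt with h | h
  · refine ⟨π, fun _ _ _ => rfl, fun y => ?_⟩
    funext k
    simp only [applyComparator, Comparator.relabel, Function.comp_apply, min_eq_left h.le,
      max_eq_right h.le, π.injective.eq_iff]
  · refine ⟨(Equiv.swap c.1 c.2).trans π, fun k h1 h2 => ?_, fun y => ?_⟩
    · simp [Equiv.swap_apply_of_ne_of_ne h1 h2]
    · funext k
      simp only [applyComparator, Comparator.relabel, Function.comp_apply, min_eq_right h.le,
        max_eq_left h.le, π.injective.eq_iff, Equiv.trans_apply]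
      by_cases h1 : k = c.1
      · simp [h1, min_comm]
      by_cases h2 : k = c.2
      · simp [h2, hc, hc.symm, max_comm]
      simp [Equiv.swap_apply_of_ne_of_ne h1 h2, h1, h2]

theorem IsLayer.exists_applyLayer_comp {α : Type*} [LinearOrder α] {l : Layer n}
    (hl : IsLayer l) (π : Equiv.Perm (Fin n)) :
    ∃ σ : Equiv.Perm (Fin n), ∀ y : Fin n → α,
      applyLayer l (y ∘ π) = applyLayer (l.map (Comparator.relabel π)) y ∘ σ := by
  induction l generalizing π with
  | nil => exact ⟨π, fun _ => rfl⟩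
  | cons c t ih =>
    obtain ⟨hlt, hdis⟩ := hl
    rw [List.pairwise_cons] at hdis
    obtain ⟨τ, hτ, hc⟩ := exists_applyComparator_comp (α := α) c (hlt c (by simp)).ne π
    obtain ⟨σ, hσ⟩ := ih ⟨fun d hd => hlt d (by simp [hd]), hdis.2⟩ τ
    have hmap : t.map (Comparator.relabel τ) = t.map (Comparator.relabel π) := by
      refine List.map_congr_left fun d hd => ?_
      obtain ⟨h1, h2, h3, h4⟩ := hdis.1 d hd
      simp only [Comparator.relabel, hτ d.1 h1.symm h3.symm, hτ d.2 h2.symm h4.symm]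
    refine ⟨σ, fun y => ?_⟩
    change applyLayer t (applyComparator c (y ∘ π)) =
      applyLayer (t.map (Comparator.relabel π)) (applyComparator (c.relabel π) y) ∘ σ
    rw [hc, hσ, hmap]

/-- Untangling: permuting the inputs of a network amounts to permuting the outputs of another
ordinary network of the same depth. -/
theorem IsNetwork.exists_applyNetwork_comp {α : Type*} [LinearOrder α] {C : Network n}
    (hC : IsNetwork C) (π : Equiv.Perm (Fin n)) :
    ∃ (N : Network n) (σ : Equiv.Perm (Fin n)), IsNetwork N ∧ N.length = C.length ∧
      ∀ y : Fin n → α, applyNetwork C (y ∘ π) = applyNetwork N y ∘ σ := by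
  induction C generalizing π with
  | nil => exact ⟨[], π, hC, rfl, fun _ => rfl⟩
  | cons l C ih =>
    have hl : IsLayer l := hC l (by simp)
    obtain ⟨τ, hτ⟩ := hl.exists_applyLayer_comp (α := α) π
    obtain ⟨N, σ, hN, hlen, hσ⟩ := ih (fun m hm => hC m (by simp [hm])) τ
    refine ⟨l.map (Comparator.relabel π) :: N, σ, ?_, by simp [hlen], fun y => ?_⟩
    · intro m hm
      rcases List.mem_cons.1 hm with rfl | hm
      · exact hl.map_relabel π
      · exact hN m hm
    · change applyNetwork C (applyLayer l (y ∘ π)) =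
        applyNetwork N (applyLayer (l.map (Comparator.relabel π)) y) ∘ σ
      rw [hτ, hσ]

/-- The channels of a layer, indexed by a comparator and one of its two ends. -/
def Layer.channel (l : Layer n) (p : Fin l.length × Bool) : Fin n :=
  if p.2 then (l.get p.1).2 else (l.get p.1).1

theorem IsLayer.channel_injective {l : Layer n} (hl : IsLayer l) :
    Function.Injective (Layer.channel l) := by
  have hdis := List.pairwise_iff_get.1 hl.2
  rintro ⟨i, a⟩ ⟨j, b⟩ h
  have hi := (hl.1 _ (l.get_mem i)).ne
  rcases lt_trichotomy i j with hij | rfl | hij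
  · have := hdis i j hij
    unfold ChDisjoint at this
    cases a <;> cases b <;> simp_all [Layer.channel]
  · cases a <;> cases b <;> simp_all [Layer.channel]
  · have := hdis j i hij
    unfold ChDisjoint at this
    cases a <;> cases b <;> simp_all [Layer.channel]

theorem IsLayer.length_le {l : Layer n} (hl : IsLayer l) : l.length ≤ n / 2 := by
  have := Fintype.card_le_of_injective _ hl.channel_injective
  simp only [Fintype.card_prod, Fintype.card_fin, Fintype.card_bool] at this
  omega

/-- A layer can be embedded in any layer with at least as many comparators by permuting
channels. -/
theorem IsLayer.exists_perm_mem {l m : Layer n} (hl : IsLayer l) (hm : IsLayer m)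
    (h : l.length ≤ m.length) :
    ∃ π : Equiv.Perm (Fin n), ∀ c ∈ l, (π c.1, π c.2) ∈ m := by
  have hinj : Function.Injective
      fun p : Fin l.length × Bool => Layer.channel m (Fin.castLE h p.1, p.2) := by
    refine hm.channel_injective.comp fun p q hpq => ?_
    simpa [Prod.ext_iff] using hpq
  let e := (Equiv.ofInjective _ hl.channel_injective).symm.trans (Equiv.ofInjective _ hinj)
  classical
  obtain ⟨π, key⟩ : ∃ π : Equiv.Perm (Fin n), ∀ p : Fin l.length × Bool,
      π (Layer.channel l p) = Layer.channel m (Fin.castLE h p.1, p.2) := by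
    refine ⟨e.extendSubtype, fun p => ?_⟩
    rw [e.extendSubtype_apply_of_mem _ ⟨p, rfl⟩]
    simp [e]
  refine ⟨π, fun c hc => ?_⟩
  obtain ⟨i, rfl⟩ := List.get_of_mem hc
  have h1 := key (i, false)
  have h2 := key (i, true)
  simp only [Layer.channel, if_true, Bool.false_eq_true, if_false] at h1 h2
  rw [h1, h2]
  exact m.get_mem _

theorem Equiv.Perm.eq_one_of_monotone_comp {σ : Equiv.Perm (Fin n)}
    (h : ∀ x : Fin n → Bool, Monotone x → Monotone (x ∘ σ)) : σ = 1 := by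
  have hmono : Monotone σ := by
    intro i j hij
    by_contra! hlt
    have := h (fun k => decide (σ j < k))
      (fun a b hab => by simpa [Bool.le_iff_imp] using fun ha => lt_of_lt_of_le ha hab) hij
    simp [hlt] at this
    exact absurd this (by decide)
  have hs : StrictMono σ := hmono.strictMono_of_injective σ.injective
  ext1 i
  exact congrArg (fun f : Fin n ≃o Fin n => f i)
    (Subsingleton.elim (hs.orderIsoOfSurjective σ σ.surjective) (OrderIso.refl _))

end

/-- for any maximal layer `L` on `n` channels, if a sorting network
with `n` channels and depth `d` exists, then one exists whose first layer is `L`. -/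
theorem statement_7 {n d : ℕ} (hd : 1 ≤ d) (L : Layer n) (hL : IsMaximalLayer L)
    (h : ∃ C : Network n, IsSortingNetwork C ∧ C.length = d) :
    ∃ N : Network n, IsSortingNetwork (L :: N) ∧ (L :: N).length = d := by
  obtain ⟨C, ⟨hC, hsort⟩, hlen⟩ := h
  obtain _ | ⟨l, R⟩ := C
  · simp at hlen; omega
  have hl : IsLayer l := hC l (by simp)
  obtain ⟨π, hπ⟩ := hl.exists_perm_mem hL.1 (hL.2 ▸ hl.length_le)
  obtain ⟨N, σ, hN, hNlen, hσ⟩ :=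
    IsNetwork.exists_applyNetwork_comp (α := Bool) (C := R) (fun m hm => hC m (by simp [hm])) π
  have hLN : IsNetwork (L :: N) := by
    intro m hm
    rcases List.mem_cons.1 hm with rfl | hm
    · exact hL.1
    · exact hN m hm
  have hmono (x : Fin n → Bool) : Monotone (applyNetwork (L :: N) x ∘ σ) := by
    change Monotone (applyNetwork N (applyLayer L x) ∘ σ)
    rw [← hσ, ← applyLayer_eq_self (l := l) (v := applyLayer L x ∘ π)
      fun c hc => hL.1.applyLayer_le x _ (hπ c hc)]
    exact hsort _
  obtain rfl : σ = 1 := Equiv.Perm.eq_one_of_monotone_comp fun x hx => by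
    simpa only [applyNetwork_eq_self hLN hx] using hmono x
  exact ⟨N, ⟨hLN, hmono⟩, by simpa [hNlen] using hlen⟩
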